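/- arXiv:2210.14051 — 2 statements merged into one kernel-verified Lean document; each statement's English description precedes it below -/
import Mathlib

section
/- Let β ≠ 0, let n ≥ 2 be an integer, and let F_1,…,F_n be probability measures on ℝ, each with finite ∫ exp(β x) integral, satisfying U_β(F_1) ≤ U_β(F_2) ≤ … ≤ U_β(F_n). Let θ and θ' be probability vectors in the n-simplex such that there exists k ∈ {1,…,n} with θ'_i ≤ θ_i for all i ≤ k and θ'_i ≥ θ_i for all i > k. Then U_β(Σ_{i=1}^n θ_i·F_i) ≤ U_β(Σ_{i=1}^n θ'_i·F_i). (Monotonicity-preserving under block-wise transport.) -/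
open MeasureTheory

/-- The entropic risk measure `U_β(μ) = β⁻¹ log (∫ exp (β x) dμ(x))`. -/
noncomputable def entRM (β : ℝ) (μ : Measure ℝ) : ℝ :=
  β⁻¹ * Real.log (∫ x, Real.exp (β * x) ∂μ)

/-- The mixture `∑ i, θ i • μ i` of finitely many measures on ℝ. -/
noncomputable def mixN {n : ℕ} (θ : Fin n → ℝ) (μ : Fin n → Measure ℝ) : Measure ℝ :=
  ∑ i, ENNReal.ofReal (θ i) • μ i

/-- The entropic transform is increasing up to the sign of `β`. -/
lemma inv_mul_log_le_inv_mul_log_iff {β a b : ℝ} (hβ : β ≠ 0) (ha : 0 < a) (hb : 0 < b) :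
    β⁻¹ * Real.log a ≤ β⁻¹ * Real.log b ↔ β * a ≤ β * b := by
  rcases lt_or_gt_of_ne hβ with h | h
  · rw [mul_le_mul_left_of_neg (inv_lt_zero.mpr h), mul_le_mul_left_of_neg h,
      Real.log_le_log_iff hb ha]
  · rw [mul_le_mul_iff_right₀ (inv_pos.mpr h), mul_le_mul_iff_right₀ h,
      Real.log_le_log_iff ha hb]

lemma integral_mixN {n : ℕ} {θ : Fin n → ℝ} (hθ : ∀ i, 0 ≤ θ i) {μ : Fin n → Measure ℝ}
    {f : ℝ → ℝ} (hf : ∀ i, Integrable f (μ i)) :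
    ∫ x, f x ∂(mixN θ μ) = ∑ i, θ i * ∫ x, f x ∂(μ i) := by
  rw [mixN, integral_finsetSum_measure fun i _ => (hf i).smul_measure ENNReal.ofReal_ne_top]
  simp [integral_smul_measure, ENNReal.toReal_ofReal (hθ _)]

lemma sum_mul_pos_of_sum_eq_one {ι : Type*} [Fintype ι] {θ m : ι → ℝ} (hθ : ∀ i, 0 ≤ θ i)
    (hsum : ∑ i, θ i = 1) (hm : ∀ i, 0 < m i) : 0 < ∑ i, θ i * m i := by
  obtain ⟨i, hi, hne⟩ := Finset.exists_ne_zero_of_sum_ne_zero (hsum.trans_ne one_ne_zero)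
  exact Finset.sum_pos' (fun j _ => mul_nonneg (hθ j) (hm j).le)
    ⟨i, hi, mul_pos ((hθ i).lt_of_ne' hne) (hm i)⟩

/-- Moving mass from indices `≤ k` to indices `> k` increases the weighted sum of a monotone
family. -/
lemma sum_mul_le_sum_mul_of_transport {ι : Type*} [Fintype ι] [LinearOrder ι]
    {θ θ' v : ι → ℝ} (hv : Monotone v) (hsum : ∑ i, θ i = ∑ i, θ' i) (k : ι)
    (hle : ∀ i, i ≤ k → θ' i ≤ θ i) (hge : ∀ i, k < i → θ i ≤ θ' i) :
    ∑ i, θ i * v i ≤ ∑ i, θ' i * v i := by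
  have h : 0 ≤ ∑ i, (θ' i - θ i) * (v i - v k) := by
    refine Finset.sum_nonneg fun i _ => ?_
    rcases le_or_gt i k with hi | hi
    · exact mul_nonneg_of_nonpos_of_nonpos (sub_nonpos.mpr (hle i hi)) (sub_nonpos.mpr (hv hi))
    · exact mul_nonneg (sub_nonneg.mpr (hge i hi)) (sub_nonneg.mpr (hv hi.le))
  simp only [mul_sub, sub_mul, Finset.sum_sub_distrib, ← Finset.sum_mul] at h
  rw [hsum] at h
  linarith

/-- Monotonicity-preserving under block-wise transport: if `θ'` moves mass from the
low-value components (indices `≤ k`) to the high-value components (indices `> k`),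
then `U_β` of the mixture cannot decrease. -/
theorem entRM_blockwise_transport
    (β : ℝ) (hβ : β ≠ 0) (n : ℕ) (hn : 2 ≤ n)
    (F : Fin n → Measure ℝ) [∀ i, IsProbabilityMeasure (F i)]
    (hFi : ∀ i, Integrable (fun x => Real.exp (β * x)) (F i))
    (hmono : ∀ i j : Fin n, i ≤ j → entRM β (F i) ≤ entRM β (F j))
    (θ θ' : Fin n → ℝ)
    (hθ0 : ∀ i, 0 ≤ θ i) (hθ1 : ∑ i, θ i = 1)
    (hθ'0 : ∀ i, 0 ≤ θ' i) (hθ'1 : ∑ i, θ' i = 1)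
    (k : Fin n)
    (hle : ∀ i, i ≤ k → θ' i ≤ θ i)
    (hge : ∀ i, k < i → θ i ≤ θ' i) :
    entRM β (mixN θ F) ≤ entRM β (mixN θ' F) := by
  have hpos : ∀ i, 0 < ∫ x, Real.exp (β * x) ∂(F i) := fun i => integral_exp_pos (hFi i)
  unfold entRM at *
  rw [integral_mixN hθ0 hFi, integral_mixN hθ'0 hFi,
    inv_mul_log_le_inv_mul_log_iff hβ (sum_mul_pos_of_sum_eq_one hθ0 hθ1 hpos)
      (sum_mul_pos_of_sum_eq_one hθ'0 hθ'1 hpos)]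
  have hv : Monotone fun i => β * ∫ x, Real.exp (β * x) ∂(F i) := fun i j hij =>
    (inv_mul_log_le_inv_mul_log_iff hβ (hpos i) (hpos j)).mp (hmono i j hij)
  simpa only [Finset.mul_sum, mul_left_comm β] using
    sum_mul_le_sum_mul_of_transport hv (hθ1.trans hθ'1.symm) k hle hge
end

section
/- Let n ≥ 2 be an integer, let M > 0, let F_1,…,F_n be CDFs of probability measures on ℝ supported in [0, M], and let θ, θ' be probability vectors in the n-simplex. If c ≥ Σ_{i=1}^n |θ_i − θ'_i|, then for every x ∈ ℝ, max(Σ_{i=1}^n θ'_i F_i(x) − c·𝟙_{[0,M)}(x), 0) ≤ Σ_{i=1}^n θ_i F_i(x); that is, the mixture Σ_i θ_i F_i is stochastically dominated by the optimistic shift O_c(Σ_i θ'_i F_i). -/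
open MeasureTheory

/-- The cumulative distribution function of a measure on ℝ. -/
noncomputable def cdfR (μ : Measure ℝ) (x : ℝ) : ℝ :=
  (μ (Set.Iic x)).toReal

/-- The distributional optimism operator on CDFs supported in `[a, b]`:
`(O_c F)(x) = max (F x - c · 𝟙_{[a,b)}(x)) 0`. -/
noncomputable def optOp (a b c : ℝ) (F : ℝ → ℝ) (x : ℝ) : ℝ :=
  max (F x - c * Set.indicator (Set.Ico a b) (fun _ => (1 : ℝ)) x) 0

theorem cdfR_nonneg (μ : Measure ℝ) (x : ℝ) : 0 ≤ cdfR μ x :=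
  ENNReal.toReal_nonneg

theorem cdfR_le_one (μ : Measure ℝ) [IsProbabilityMeasure μ] (x : ℝ) : cdfR μ x ≤ 1 :=
  measureReal_le_one

theorem cdfR_eq_zero_of_lt {μ : Measure ℝ} [IsProbabilityMeasure μ] {a b x : ℝ}
    (h : μ (Set.Icc a b) = 1) (hx : x < a) : cdfR μ x = 0 := by
  have h_compl : μ (Set.Icc a b)ᶜ = 0 := (prob_compl_eq_zero_iff measurableSet_Icc).2 h
  have h_Iic : μ (Set.Iic x) = 0 :=
    measure_mono_null (t := (Set.Icc a b)ᶜ)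
      (fun _ (hy : _ ≤ x) hy' => (hy'.1.trans hy).not_gt hx) h_compl
  simp [cdfR, h_Iic]

theorem cdfR_eq_one_of_le {μ : Measure ℝ} [IsProbabilityMeasure μ] {a b x : ℝ}
    (h : μ (Set.Icc a b) = 1) (hx : b ≤ x) : cdfR μ x = 1 := by
  have h_Iic : μ (Set.Iic x) = 1 :=
    le_antisymm prob_le_one (h ▸ measure_mono fun y hy => hy.2.trans hx)
  simp [cdfR, h_Iic]

theorem sum_mul_sub_sum_mul_le_sum_abs_sub {ι : Type*} (s : Finset ι) (u v f : ι → ℝ)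
    (hf0 : ∀ i, 0 ≤ f i) (hf1 : ∀ i, f i ≤ 1) :
    ∑ i ∈ s, v i * f i - ∑ i ∈ s, u i * f i ≤ ∑ i ∈ s, |u i - v i| := by
  rw [← Finset.sum_sub_distrib]
  refine Finset.sum_le_sum fun i _ => ?_
  calc v i * f i - u i * f i = (v i - u i) * f i := by ring
    _ ≤ |v i - u i| * f i := mul_le_mul_of_nonneg_right (le_abs_self _) (hf0 i)
    _ ≤ |v i - u i| := mul_le_of_le_one_right (abs_nonneg _) (hf1 i)
    _ = |u i - v i| := abs_sub_comm _ _

/-- Bound on the optimistic constant: if `c ≥ ∑ i, |θ i - θ' i|`, then the mixture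
`∑ i, θ i F i` stochastically dominates... more precisely, for every `x`,
`O_c (∑ i, θ' i F i) (x) ≤ ∑ i, θ i F i (x)`. -/
theorem optOp_mixture_dominates
    (n : ℕ) (hn : 2 ≤ n) (M : ℝ) (hM : 0 < M)
    (μ : Fin n → Measure ℝ) [∀ i, IsProbabilityMeasure (μ i)]
    (hsupp : ∀ i, μ i (Set.Icc (0 : ℝ) M) = 1)
    (θ θ' : Fin n → ℝ)
    (hθ0 : ∀ i, 0 ≤ θ i) (hθ1 : ∑ i, θ i = 1)
    (hθ'0 : ∀ i, 0 ≤ θ' i) (hθ'1 : ∑ i, θ' i = 1)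
    (c : ℝ) (hc : ∑ i, |θ i - θ' i| ≤ c) :
    ∀ x : ℝ, optOp 0 M c (fun y => ∑ i, θ' i * cdfR (μ i) y) x ≤
      ∑ i, θ i * cdfR (μ i) x := by
  intro x
  refine max_le ?_ (Finset.sum_nonneg fun i _ => mul_nonneg (hθ0 i) (cdfR_nonneg _ _))
  rcases lt_or_ge x 0 with hx | hx
  · simp [cdfR_eq_zero_of_lt (hsupp _) hx, hx.not_ge]
  rcases le_or_gt M x with hMx | hMx
  · simp [cdfR_eq_one_of_le (hsupp _) hMx, hMx.not_gt, hθ1, hθ'1]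
  · rw [Set.indicator_of_mem (Set.mem_Ico.2 ⟨hx, hMx⟩)]
    linarith [sum_mul_sub_sum_mul_le_sum_abs_sub Finset.univ θ θ' (fun i => cdfR (μ i) x)
      (fun i => cdfR_nonneg _ _) (fun i => cdfR_le_one _ _)]
end
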